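/- arXiv:2110.01099 — 3 statements merged into one kernel-verified Lean document; each statement's English description precedes it below -/
import Mathlib

section
/- Translational Lyapunov derivative bound (equation (43) in the proof of Proposition 2): let m, k_p, k_v, c_p > 0, α ∈ (0,1), B_f > 0, B_p > 0. Let e_p, e_v, f̄ ∈ ℝ³ and x ≥ 0 satisfy ‖f̄‖ ≤ 4x(k_p‖e_p‖ + k_v‖e_v‖ + B_f), 4x ≤ α, and ‖e_p‖ ≤ B_p. Then −(k_v − c_p)‖e_v‖² − (c_p k_p/m)‖e_p‖² − (c_p k_v/m)(e_p·e_v) + f̄·((c_p/m) e_p + e_v) ≤ −z_pᵀ W^{pp} z_p + z_pᵀ W^{pa} z_a, where z_p = (‖e_p‖, ‖e_v‖), z_a = (x, y) for any y ≥ 0, W^{pp} = [[c_p k_p(1−α)/m, −c_p k_v(1+α)/(2m)],[−c_p k_v(1+α)/(2m), k_v(1−α) − c_p]], and W^{pa} = 4[[B_f c_p/m, 0],[B_f + k_p B_p, 0]]. -/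
noncomputable section

open Matrix

/-- Euclidean inner product on ℝ³. -/
def dot3 (a b : Fin 3 → ℝ) : ℝ := ∑ i, a i * b i

/-- Euclidean norm on ℝ³. -/
def norm3 (a : Fin 3 → ℝ) : ℝ := Real.sqrt (dot3 a a)

def Wpp (kp kv cp m α : ℝ) : Matrix (Fin 2) (Fin 2) ℝ :=
  !![cp * kp * (1 - α) / m, -(cp * kv * (1 + α)) / (2 * m);
     -(cp * kv * (1 + α)) / (2 * m), kv * (1 - α) - cp]

def Wpa (Bf cp m kp Bp : ℝ) : Matrix (Fin 2) (Fin 2) ℝ :=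
  (4 : ℝ) • !![Bf * cp / m, 0; Bf + kp * Bp, 0]

lemma dot3_self_nonneg (a : Fin 3 → ℝ) : 0 ≤ dot3 a a :=
  Finset.sum_nonneg fun i _ => mul_self_nonneg (a i)

lemma abs_dot3_le (a b : Fin 3 → ℝ) : |dot3 a b| ≤ norm3 a * norm3 b := by
  rw [norm3, norm3, ← Real.sqrt_mul (dot3_self_nonneg a)]
  refine Real.abs_le_sqrt ?_
  simpa only [dot3, sq] using Finset.sum_mul_sq_le_sq_mul_sq Finset.univ a b

lemma dot3_smul_add (f a b : Fin 3 → ℝ) (c : ℝ) :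
    dot3 f (c • a + b) = c * dot3 f a + dot3 f b := by
  simp only [dot3, Fin.sum_univ_three, Pi.add_apply, Pi.smul_apply, smul_eq_mul]
  ring

/-- Translational Lyapunov derivative bound (equation (43) in the proof of
Proposition 2). -/
theorem translational_lyapunov_derivative_bound
    (m kp kv cp α Bf Bp : ℝ)
    (hm : 0 < m) (hkp : 0 < kp) (hkv : 0 < kv) (hcp : 0 < cp)
    (hα0 : 0 < α) (hα1 : α < 1) (hBf : 0 < Bf) (hBp : 0 < Bp)
    (ep ev fbar : Fin 3 → ℝ) (x y : ℝ) (hx : 0 ≤ x) (hy : 0 ≤ y)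
    (hfbar : norm3 fbar ≤ 4 * x * (kp * norm3 ep + kv * norm3 ev + Bf))
    (hxα : 4 * x ≤ α)
    (hep : norm3 ep ≤ Bp) :
    -((kv - cp) * norm3 ev ^ 2) - cp * kp / m * norm3 ep ^ 2
        - cp * kv / m * dot3 ep ev
        + dot3 fbar ((cp / m) • ep + ev) ≤
      -(![norm3 ep, norm3 ev] ⬝ᵥ (Wpp kp kv cp m α).mulVec ![norm3 ep, norm3 ev])
        + ![norm3 ep, norm3 ev] ⬝ᵥ (Wpa Bf cp m kp Bp).mulVec ![x, y] := by
  have hc : 0 < cp / m := div_pos hcp hm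
  have hp : 0 ≤ norm3 ep := Real.sqrt_nonneg _
  have hv : 0 ≤ norm3 ev := Real.sqrt_nonneg _
  have h_pv := neg_le_of_abs_le (abs_dot3_le ep ev)
  have h_fp := le_of_abs_le (abs_dot3_le fbar ep)
  have h_fv := le_of_abs_le (abs_dot3_le fbar ev)
  rw [dot3_smul_add]
  generalize norm3 ep = p at *
  generalize norm3 ev = v at *
  have h_rhs : -(![p, v] ⬝ᵥ (Wpp kp kv cp m α).mulVec ![p, v])
        + ![p, v] ⬝ᵥ (Wpa Bf cp m kp Bp).mulVec ![x, y]
      = -(cp / m * kp * (1 - α) * p ^ 2 - cp / m * kv * (1 + α) * (p * v)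
          + (kv * (1 - α) - cp) * v ^ 2)
        + 4 * x * (Bf * (cp / m) * p + (Bf + kp * Bp) * v) := by
    simp [Wpp, Wpa, dotProduct, Matrix.mulVec, Fin.sum_univ_two]
    field_simp
    ring
  rw [h_rhs, mul_div_right_comm cp kp m, mul_div_right_comm cp kv m]
  generalize cp / m = c at *
  have h_cross : -(c * kv * dot3 ep ev) ≤ c * kv * (p * v) := by
    rw [← mul_neg]
    exact mul_le_mul_of_nonneg_left (by linarith) (by positivity)
  have h_force : c * dot3 fbar ep + dot3 fbar ev
      ≤ 4 * x * (kp * p + kv * v + Bf) * (c * p + v) :=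
    calc c * dot3 fbar ep + dot3 fbar ev
        ≤ c * (norm3 fbar * p) + norm3 fbar * v := by gcongr
      _ = norm3 fbar * (c * p + v) := by ring
      _ ≤ _ := by gcongr
  have h_gain : 4 * x * (c * kp * p ^ 2 + c * kv * (p * v) + kv * v ^ 2)
      ≤ α * (c * kp * p ^ 2 + c * kv * (p * v) + kv * v ^ 2) := by gcongr
  have h_pos : 4 * x * (kp * p * v) ≤ 4 * x * (kp * Bp * v) := by gcongr
  linarith

end
end

section
/- Sufficient condition on the translational cross-gain c_p (Assumption (A5) comment): let m, k_p, k_v > 0 and α ∈ (0,1). If 0 < c_p < min{ k_v(1−α), 4 m k_p k_v (1−α)² / (k_v²(1+α)² + 4 m k_p (1−α)), √(k_p m) }, then the matrices M₁^{pp} = ½[[k_p, −c_p],[−c_p, m]], M₂^{pp} = ½[[k_p, c_p],[c_p, m]], and W^{pp} = [[c_p k_p(1−α)/m, −c_p k_v(1+α)/(2m)],[−c_p k_v(1+α)/(2m), k_v(1−α) − c_p]] are all positive definite. -/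
noncomputable section

open Matrix

def M1pp (kp cp m : ℝ) : Matrix (Fin 2) (Fin 2) ℝ :=
  (1 / 2 : ℝ) • !![kp, -cp; -cp, m]

def M2pp (kp cp m : ℝ) : Matrix (Fin 2) (Fin 2) ℝ :=
  (1 / 2 : ℝ) • !![kp, cp; cp, m]

theorem posDef_fin_two_of_sq_lt {a b c : ℝ} (ha : 0 < a) (h : b ^ 2 < a * c) :
    (!![a, b; b, c] : Matrix (Fin 2) (Fin 2) ℝ).PosDef := by
  rw [Matrix.posDef_iff_dotProduct_mulVec]
  refine ⟨?_, fun {x} hx => ?_⟩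
  · ext i j
    fin_cases i <;> fin_cases j <;> simp
  · have hq : 0 < (a * x 0 + b * x 1) ^ 2 + (a * c - b ^ 2) * x 1 ^ 2 := by
      by_cases h1 : x 1 = 0
      · have h0 : x 0 ≠ 0 := by
          intro h0
          apply hx
          ext i
          fin_cases i
          · exact h0
          · exact h1
        have : a * x 0 ≠ 0 := mul_ne_zero ha.ne' h0
        simp only [h1, mul_zero, add_zero]
        positivity
      · have : 0 < a * c - b ^ 2 := sub_pos.mpr h
        positivity
    have he : a * (star x ⬝ᵥ !![a, b; b, c] *ᵥ x) =
        (a * x 0 + b * x 1) ^ 2 + (a * c - b ^ 2) * x 1 ^ 2 := by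
      simp [dotProduct, mulVec, Fin.sum_univ_two]
      ring
    exact pos_of_mul_pos_right (he ▸ hq) ha.le

/-- Sufficient condition on the translational cross-gain c_p: if
0 < c_p < min{k_v(1−α), 4mk_pk_v(1−α)²/(k_v²(1+α)²+4mk_p(1−α)), √(k_pm)}
then M₁^{pp}, M₂^{pp} and W^{pp} are all positive definite. -/
theorem cp_sufficient_condition
    (m kp kv α cp : ℝ) (hm : 0 < m) (hkp : 0 < kp) (hkv : 0 < kv)
    (hα0 : 0 < α) (hα1 : α < 1)
    (hcp0 : 0 < cp)
    (hcp : cp < min (kv * (1 - α))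
        (min (4 * m * kp * kv * (1 - α) ^ 2 /
            (kv ^ 2 * (1 + α) ^ 2 + 4 * m * kp * (1 - α)))
          (Real.sqrt (kp * m)))) :
    (M1pp kp cp m).PosDef ∧ (M2pp kp cp m).PosDef ∧ (Wpp kp kv cp m α).PosDef := by
  obtain ⟨-, hcp2, hcp3⟩ : _ ∧ _ ∧ _ := by simpa only [lt_min_iff] using hcp
  have hα : 0 < 1 - α := sub_pos.mpr hα1
  have hsq : cp ^ 2 < kp * m := (Real.lt_sqrt hcp0.le).mp hcp3
  refine ⟨?_, ?_, ?_⟩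
  · exact (posDef_fin_two_of_sq_lt hkp (by rwa [neg_sq])).smul one_half_pos
  · exact (posDef_fin_two_of_sq_lt hkp hsq).smul one_half_pos
  · apply posDef_fin_two_of_sq_lt (by positivity)
    rw [lt_div_iff₀ (by positivity)] at hcp2
    have hdet : cp * kp * (1 - α) / m * (kv * (1 - α) - cp) -
        (-(cp * kv * (1 + α)) / (2 * m)) ^ 2 =
        cp / (4 * m ^ 2) * (4 * m * kp * kv * (1 - α) ^ 2 -
          cp * (kv ^ 2 * (1 + α) ^ 2 + 4 * m * kp * (1 - α))) := by
      field_simp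
      ring
    rw [← sub_pos, hdet]
    exact mul_pos (by positivity) (sub_pos.mpr hcp2)

end
end

section
/- Sufficient condition on the attitude cross-gain k_c (Assumption (A5) comment): let J ∈ ℝ^{3×3} be symmetric positive definite with smallest and largest eigenvalues λmin(J), λmax(J), let k_X, k_ω > 0 and φ ∈ (0,2). If 0 < k_c < min{ 4 k_ω, 4 k_ω k_X λmin(J)² / (λmax(J) k_ω² + λmin(J)² k_X), 2√(k_X λmin(J)) }, then the matrices W^{aa} = [[k_c k_X/λmax(J), −k_c k_ω/(2λmin(J))],[−k_c k_ω/(2λmin(J)), k_ω − k_c/4]], M₁^{aa} = ½[[4k_X, −k_c],[−k_c, λmin(J)]], and M₂^{aa} = ½[[8k_X/(2−φ), k_c],[k_c, λmax(J)]] are all positive definite. -/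
noncomputable section

open Matrix

/-- Smallest eigenvalue of a symmetric 3×3 matrix via the Rayleigh quotient. -/
def lamMin3 (A : Matrix (Fin 3) (Fin 3) ℝ) : ℝ :=
  sInf {r | ∃ v : Fin 3 → ℝ, norm3 v = 1 ∧ r = dot3 v (A.mulVec v)}

/-- Largest eigenvalue of a symmetric 3×3 matrix via the Rayleigh quotient. -/
def lamMax3 (A : Matrix (Fin 3) (Fin 3) ℝ) : ℝ :=
  sSup {r | ∃ v : Fin 3 → ℝ, norm3 v = 1 ∧ r = dot3 v (A.mulVec v)}

def Waa (kX kw kc lmin lmax : ℝ) : Matrix (Fin 2) (Fin 2) ℝ :=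
  !![kc * kX / lmax, -(kc * kw) / (2 * lmin);
     -(kc * kw) / (2 * lmin), kw - kc / 4]

def M1aa (kX kc lmin : ℝ) : Matrix (Fin 2) (Fin 2) ℝ :=
  (1 / 2 : ℝ) • !![4 * kX, -kc; -kc, lmin]

def M2aa (kX kc lmax φ : ℝ) : Matrix (Fin 2) (Fin 2) ℝ :=
  (1 / 2 : ℝ) • !![8 * kX / (2 - φ), kc; kc, lmax]

theorem dot3_eq_dotProduct (a b : Fin 3 → ℝ) : dot3 a b = a ⬝ᵥ b := rfl

theorem abs_apply_le_one_of_norm3_eq_one {v : Fin 3 → ℝ} (hv : norm3 v = 1) (i : Fin 3) :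
    |v i| ≤ 1 := by
  have h : dot3 v v = 1 := Real.sqrt_eq_one.mp hv
  rw [← sq_le_one_iff_abs_le_one, ← h, pow_two]
  exact Finset.single_le_sum (f := fun i => v i * v i)
    (fun j _ => mul_self_nonneg (v j)) (Finset.mem_univ i)

theorem bddAbove_rayleigh (A : Matrix (Fin 3) (Fin 3) ℝ) :
    BddAbove {r | ∃ v : Fin 3 → ℝ, norm3 v = 1 ∧ r = dot3 v (A.mulVec v)} := by
  refine ⟨∑ i, ∑ j, |A i j|, ?_⟩
  rintro _ ⟨v, hv, rfl⟩
  simp only [dot3, mulVec, dotProduct, Finset.mul_sum]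
  refine Finset.sum_le_sum fun i _ => Finset.sum_le_sum fun j _ => ?_
  calc v i * (A i j * v j) ≤ |v i * (A i j * v j)| := le_abs_self _
    _ = |A i j| * (|v i| * |v j|) := by rw [abs_mul, abs_mul]; ring
    _ ≤ |A i j| * 1 := by
      gcongr
      exact mul_le_one₀ (abs_apply_le_one_of_norm3_eq_one hv i) (abs_nonneg _)
        (abs_apply_le_one_of_norm3_eq_one hv j)
    _ = |A i j| := mul_one _

theorem Matrix.PosSemidef.bddBelow_rayleigh {A : Matrix (Fin 3) (Fin 3) ℝ} (hA : A.PosSemidef) :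
    BddBelow {r | ∃ v : Fin 3 → ℝ, norm3 v = 1 ∧ r = dot3 v (A.mulVec v)} := by
  refine ⟨0, ?_⟩
  rintro _ ⟨v, -, rfl⟩
  exact hA.dotProduct_mulVec_nonneg v

theorem Matrix.PosSemidef.lamMin3_le_lamMax3 {A : Matrix (Fin 3) (Fin 3) ℝ}
    (hA : A.PosSemidef) : lamMin3 A ≤ lamMax3 A := by
  refine csInf_le_csSup ?_ hA.bddBelow_rayleigh (bddAbove_rayleigh A)
  exact ⟨_, Pi.single 0 1, by simp [norm3, dot3_eq_dotProduct], rfl⟩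

theorem posDef_two_of_sq_lt_mul {a b d : ℝ} (ha : 0 < a) (h : b ^ 2 < a * d) :
    (!![a, b; b, d] : Matrix (Fin 2) (Fin 2) ℝ).PosDef := by
  refine .of_dotProduct_mulVec_pos ?_ fun x hx => ?_
  · ext i j
    fin_cases i <;> fin_cases j <;> simp
  · simp only [dotProduct, mulVec, Fin.sum_univ_two, star_trivial, of_apply, cons_val_zero,
      cons_val_one, cons_val', cons_val_fin_one]
    refine pos_of_mul_pos_right (a := a) ?_ ha.le
    have key : a * (x 0 * (a * x 0 + b * x 1) + x 1 * (b * x 0 + d * x 1)) =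
        (a * x 0 + b * x 1) ^ 2 + (a * d - b ^ 2) * x 1 ^ 2 := by ring
    rw [key]
    by_cases h1 : x 1 = 0
    · have h0 : x 0 ≠ 0 := fun h0 => hx (by ext i; fin_cases i <;> simp [h0, h1])
      simp only [h1, mul_zero, add_zero]
      positivity
    · have := sub_pos.mpr h
      positivity

/-- Sufficient condition on the attitude cross-gain k_c: if
0 < k_c < min{4k_ω, 4k_ωk_Xλmin(J)²/(λmax(J)k_ω²+λmin(J)²k_X), 2√(k_Xλmin(J))}
then W^{aa}, M₁^{aa} and M₂^{aa} are all positive definite. -/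
theorem kc_sufficient_condition
    (J : Matrix (Fin 3) (Fin 3) ℝ) (hJherm : J.IsHermitian) (hJpd : J.PosDef)
    (kX kw φ kc : ℝ) (hkX : 0 < kX) (hkw : 0 < kw)
    (hφ0 : 0 < φ) (hφ2 : φ < 2)
    (hkc0 : 0 < kc)
    (hkc : kc < min (4 * kw)
        (min (4 * kw * kX * lamMin3 J ^ 2 /
            (lamMax3 J * kw ^ 2 + lamMin3 J ^ 2 * kX))
          (2 * Real.sqrt (kX * lamMin3 J)))) :
    (Waa kX kw kc (lamMin3 J) (lamMax3 J)).PosDef ∧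
    (M1aa kX kc (lamMin3 J)).PosDef ∧
    (M2aa kX kc (lamMax3 J) φ).PosDef := by
  obtain ⟨_, hkc2, hkc3⟩ : _ ∧ _ ∧ _ := by simpa only [lt_min_iff] using hkc
  have hle := hJpd.posSemidef.lamMin3_le_lamMax3
  have hl : 0 < lamMin3 J := by
    have : 0 < √(kX * lamMin3 J) := by linarith
    exact pos_of_mul_pos_right (Real.sqrt_pos.mp this) hkX.le
  generalize lamMin3 J = l at *
  generalize lamMax3 J = L at *
  have hL : 0 < L := hl.trans_le hle
  have hsq : kc ^ 2 < 4 * (kX * l) := by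
    calc kc ^ 2 < (2 * √(kX * l)) ^ 2 := by gcongr
      _ = 4 * (kX * l) := by rw [mul_pow, Real.sq_sqrt (by positivity)]; norm_num
  refine ⟨posDef_two_of_sq_lt_mul (by positivity) ?_,
    (posDef_two_of_sq_lt_mul (by positivity) ?_).smul (by norm_num),
    (posDef_two_of_sq_lt_mul (div_pos (by positivity) (by linarith)) ?_).smul (by norm_num)⟩
  · rw [lt_div_iff₀ (by positivity)] at hkc2
    rw [← sub_pos]
    have key : kc * kX / L * (kw - kc / 4) - (-(kc * kw) / (2 * l)) ^ 2 =
        kc * (4 * kw * kX * l ^ 2 - kc * (L * kw ^ 2 + l ^ 2 * kX)) / (4 * l ^ 2 * L) := by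
      field_simp
      ring
    rw [key]
    have := sub_pos.mpr hkc2
    positivity
  · linarith [neg_sq kc]
  · have h4 : 4 * kX ≤ 8 * kX / (2 - φ) := by
      rw [le_div_iff₀ (by linarith)]
      nlinarith
    calc kc ^ 2 < 4 * kX * l := by linarith
      _ ≤ 8 * kX / (2 - φ) * L := by gcongr

end
end
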